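/- Under the closed-loop safe-following dynamics, the velocity error converges: v₂(t) − v₁(t) → 0 as t → ∞; that is, the follower's velocity asymptotically approaches the leader's velocity. -/

import Mathlib

/-- Safe-following distance. -/
noncomputable def Dsafe (um L v₁ v₂ : ℝ) : ℝ :=
  L + max 0 ((v₂ ^ 2 - v₁ ^ 2) / (-2 * um))

/-- Unsaturated safe-following control (for `v₂ > 0`, `σ ≠ 0`). -/
noncomputable def gus (um v₁ v₂ σ u : ℝ) : ℝ :=
  (v₁ / v₂ * (1 + σ * u / (-um)) - 1) * (-um / σ)

/-- Safety ratio. -/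
noncomputable def ratio (um L : ℝ) (x₁ x₂ v₁ v₂ : ℝ → ℝ) (t : ℝ) : ℝ :=
  (x₁ t - x₂ t) / Dsafe um L (v₁ t) (v₂ t)

theorem nonneg_of_deriv_nonneg_of_neg {W W' : ℝ → ℝ} {p q : ℝ}
    (hW : ∀ t ∈ Set.Icc p q, HasDerivAt W (W' t) t) (hp : 0 ≤ W p)
    (hW' : ∀ t ∈ Set.Icc p q, W t < 0 → 0 ≤ W' t) :
    ∀ t ∈ Set.Icc p q, 0 ≤ W t := by
  intro t ht
  have key : ∀ ε : ℝ, 0 < ε → -W t ≤ ε * (t - p + 1) := by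
    intro ε hε
    refine image_le_of_deriv_right_lt_deriv_boundary (f := fun s => -W s) (f' := fun s => -W' s)
      (B := fun s => ε * (s - p + 1)) (B' := fun _ => ε) (a := p) (b := q)
      (fun s hs => (hW s hs).neg.continuousAt.continuousWithinAt)
      (fun s hs => (hW s ⟨hs.1, hs.2.le⟩).neg.hasDerivWithinAt) ?_ ?_ ?_ ht
    · simp only [sub_self, zero_add, mul_one]
      linarith
    · intro s
      simpa using (((hasDerivAt_id s).sub_const p).add_const 1).const_mul ε
    · intro s hs h
      have h1 : 0 < ε * (s - p + 1) := mul_pos hε (by linarith [hs.1])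
      have h2 := hW' s ⟨hs.1, hs.2.le⟩ (by linarith)
      linarith
  by_contra! hneg
  have hpos : 0 < t - p + 1 := by linarith [ht.1]
  have h := key (-W t / (2 * (t - p + 1))) (by apply div_pos <;> linarith)
  have h2 : -W t / (2 * (t - p + 1)) * (t - p + 1) = -W t / 2 := by
    field_simp
  linarith

theorem Dsafe_pos {um L : ℝ} (hL : 0 < L) (a b : ℝ) : 0 < Dsafe um L a b :=
  add_pos_of_pos_of_nonneg hL (le_max_left _ _)

theorem Dsafe_of_le {um L a b : ℝ} (hum : um < 0) (h : 0 ≤ b ^ 2 - a ^ 2) :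
    Dsafe um L a b = L + (b ^ 2 - a ^ 2) / (-2 * um) := by
  rw [Dsafe, max_eq_right (div_nonneg h (by linarith))]

/-- The safe-following control dissipates the kinetic-energy gap at rate
`-2 * um / σ * (v₂ - v₁)`. -/
theorem hasDerivAt_sq_sub_sq {um u : ℝ} {v₁ v₂ σ : ℝ → ℝ} {t : ℝ}
    (hpos : 0 < v₂ t) (hσ : σ t ≠ 0) (hum : um < 0)
    (h₁ : HasDerivAt v₁ u t) (h₂ : HasDerivAt v₂ (gus um (v₁ t) (v₂ t) (σ t) u) t) :
    HasDerivAt (fun s => v₂ s ^ 2 - v₁ s ^ 2) (2 * um / σ t * (v₂ t - v₁ t)) t := by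
  refine ((h₂.pow 2).sub (h₁.pow 2)).congr_deriv ?_
  have := hum.ne
  unfold gus
  field_simp
  ring

theorem ratio_hasDerivAt_zero {um L σ : ℝ} {x₁ x₂ v₁ v₂ : ℝ → ℝ} {t : ℝ} (hum : um < 0)
    (hL : 0 < L) (hσ : σ ≠ 0)
    (hx₁ : HasDerivAt x₁ (v₁ t) t) (hx₂ : HasDerivAt x₂ (v₂ t) t)
    (hW : HasDerivAt (fun s => v₂ s ^ 2 - v₁ s ^ 2) (2 * um / σ * (v₂ t - v₁ t)) t)
    (hnn : 0 ≤ v₂ t ^ 2 - v₁ t ^ 2) (hr : ratio um L x₁ x₂ v₁ v₂ t = σ) :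
    HasDerivAt (fun s => (x₁ s - x₂ s) / (L + (v₂ s ^ 2 - v₁ s ^ 2) / (-2 * um))) 0 t := by
  have hD := Dsafe_pos (um := um) hL (v₁ t) (v₂ t)
  rw [ratio, div_eq_iff hD.ne'] at hr
  rw [Dsafe_of_le hum hnn] at hr hD
  refine ((hx₁.sub hx₂).div ((hW.div_const (-2 * um)).const_add L) hD.ne').congr_deriv ?_
  simp only [Pi.sub_apply]
  rw [hr]
  rw [div_eq_zero_iff]
  left
  have hs : σ * (2 * um / σ * (v₂ t - v₁ t) / (-2 * um)) = -(v₂ t - v₁ t) := by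
    have := hum.ne
    field_simp
  linear_combination (-(L + (v₂ t ^ 2 - v₁ t ^ 2) / (-2 * um))) * hs

/-- under the closed-loop safe-following dynamics, the velocity error v₂ − v₁ converges to 0 as t → ∞. -/
theorem closed_loop_velocity_convergence
    (um uM L σ₀ V : ℝ) (hum : um < 0) (huM : 0 < uM) (hL : 0 < L)
    (hσ₀ : 1 < σ₀) (hV : 0 ≤ V)
    (x₁ x₂ v₁ v₂ u₁ : ℝ → ℝ)
    (hx₁ : ∀ t : ℝ, 0 ≤ t → HasDerivAt x₁ (v₁ t) t)
    (hx₂ : ∀ t : ℝ, 0 ≤ t → HasDerivAt x₂ (v₂ t) t)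
    (hv₁ : ∀ t : ℝ, 0 ≤ t → HasDerivAt v₁ (u₁ t) t)
    (hu₁ : ∀ t : ℝ, 0 ≤ t → u₁ t ∈ Set.Icc um uM)
    (hv₁bnd : ∀ t : ℝ, 0 ≤ t → v₁ t ∈ Set.Icc 0 V)
    (hv₂pos : ∀ t : ℝ, 0 ≤ t → 0 < v₂ t)
    (hv₂ : ∀ t : ℝ, 0 ≤ t →
      HasDerivAt v₂ (gus um (v₁ t) (v₂ t) (ratio um L x₁ x₂ v₁ v₂ t) (u₁ t)) t)
    (hinit : v₁ 0 ≤ v₂ 0)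
    (hσinit : ratio um L x₁ x₂ v₁ v₂ 0 ∈ Set.Icc 1 σ₀) :
    Filter.Tendsto (fun t => v₂ t - v₁ t) Filter.atTop (nhds 0) := by
  set σ : ℝ → ℝ := ratio um L x₁ x₂ v₁ v₂ with hσdef
  have hσcont : ∀ t, 0 ≤ t → ContinuousAt σ t := by
    intro t ht
    have h1 := (hv₁ t ht).continuousAt
    have h2 := (hv₂ t ht).continuousAt
    refine ((hx₁ t ht).continuousAt.sub (hx₂ t ht).continuousAt).div ?_ (Dsafe_pos hL _ _).ne'
    exact continuousAt_const.add
      (continuousAt_const.max (((h2.pow 2).sub (h1.pow 2)).div_const _))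
  have hWcont : ∀ t, 0 ≤ t → ContinuousAt (fun s => v₂ s ^ 2 - v₁ s ^ 2) t := fun t ht =>
    ((hv₂ t ht).continuousAt.pow 2).sub ((hv₁ t ht).continuousAt.pow 2)
  have hWderiv : ∀ t, 0 ≤ t → σ t ≠ 0 → HasDerivAt (fun s => v₂ s ^ 2 - v₁ s ^ 2)
      (2 * um / σ t * (v₂ t - v₁ t)) t := fun t ht hσ =>
    hasDerivAt_sq_sub_sq (hv₂pos t ht) hσ hum (hv₁ t ht) (hv₂ t ht)
  have hc : 0 < σ 0 := by linarith [hσinit.1]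
  have hinv : ∀ t, 0 ≤ t → 0 ≤ v₂ t ^ 2 - v₁ t ^ 2 ∧ σ t = σ 0 := by
    intro b hb
    have hsub : Set.Icc 0 b ⊆ {t | 0 ≤ v₂ t ^ 2 - v₁ t ^ 2 ∧ σ t = σ 0} := by
      refine IsClosed.Icc_subset_of_forall_mem_nhdsWithin ?_ ?_ ?_
      · have hW' : ContinuousOn (fun s => v₂ s ^ 2 - v₁ s ^ 2) (Set.Icc 0 b) :=
          fun t ht => (hWcont t ht.1).continuousWithinAt
        have hσ' : ContinuousOn σ (Set.Icc 0 b) :=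
          fun t ht => (hσcont t ht.1).continuousWithinAt
        have e1 := hW'.preimage_isClosed_of_isClosed isClosed_Icc (isClosed_Ici (a := (0 : ℝ)))
        have e2 := hσ'.preimage_isClosed_of_isClosed isClosed_Icc (isClosed_singleton (x := σ 0))
        convert e1.inter e2 using 1
        ext t
        simp only [Set.mem_inter_iff, Set.mem_ofPred_eq, Set.mem_preimage, Set.mem_Ici,
          Set.mem_singleton_iff]
        tauto
      · refine ⟨?_, rfl⟩
        nlinarith [(hv₁bnd 0 le_rfl).1]
      · rintro t ⟨⟨hWt, hσt⟩, ht0, -⟩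
        have hpos : ∀ᶠ s in nhds t, 0 < σ s :=
          (hσcont t ht0).eventually (lt_mem_nhds (by rw [hσt]; exact hc))
        obtain ⟨δ, hδ, hball⟩ := Metric.eventually_nhds_iff.1 hpos
        have hσpos : ∀ s ∈ Set.Icc t (t + δ / 2), 0 < σ s := fun s hs => hball (by
          rw [Real.dist_eq, abs_lt]
          constructor <;> linarith [hs.1, hs.2])
        have hnn := nonneg_of_deriv_nonneg_of_neg (p := t) (q := t + δ / 2)
          (fun s hs => hWderiv s (ht0.trans hs.1) (hσpos s hs).ne') hWt (by
            intro s hs hneg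
            have h1 := (hv₁bnd s (ht0.trans hs.1)).1
            have h2 := hv₂pos s (ht0.trans hs.1)
            have h3 : v₂ s - v₁ s ≤ 0 := by
              by_contra! h
              nlinarith
            exact mul_nonneg_of_nonpos_of_nonpos
              (div_nonpos_of_nonpos_of_nonneg (by linarith) (hσpos s hs).le) h3)
        have heq : ∀ s ∈ Set.Icc t (t + δ / 2),
            σ s = (x₁ s - x₂ s) / (L + (v₂ s ^ 2 - v₁ s ^ 2) / (-2 * um)) := fun s hs => by
          rw [hσdef, ratio, Dsafe_of_le hum (hnn s hs)]
        have hder : ∀ s ∈ Set.Icc t (t + δ / 2), HasDerivAt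
            (fun r => (x₁ r - x₂ r) / (L + (v₂ r ^ 2 - v₁ r ^ 2) / (-2 * um))) 0 s := fun s hs =>
          ratio_hasDerivAt_zero hum hL (hσpos s hs).ne' (hx₁ s (ht0.trans hs.1))
            (hx₂ s (ht0.trans hs.1)) (hWderiv s (ht0.trans hs.1) (hσpos s hs).ne') (hnn s hs) rfl
        have hconst := constant_of_has_deriv_right_zero
          (fun s hs => (hder s hs).continuousAt.continuousWithinAt)
          (fun s hs => (hder s ⟨hs.1, hs.2.le⟩).hasDerivWithinAt)
        filter_upwards [Ioc_mem_nhdsGT (show t < t + δ / 2 by linarith)] with s hs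
        have hs' : s ∈ Set.Icc t (t + δ / 2) := ⟨hs.1.le, hs.2⟩
        refine ⟨hnn s hs', ?_⟩
        rw [heq s hs', hconst s hs', ← heq t ⟨le_rfl, by linarith⟩, hσt]
    exact hsub ⟨hb, le_rfl⟩
  set W : ℝ → ℝ := fun s => v₂ s ^ 2 - v₁ s ^ 2 with hWdef
  have hWd : ∀ t, 0 ≤ t → HasDerivAt W (2 * um / σ 0 * (v₂ t - v₁ t)) t := fun t ht => by
    have h := hWderiv t ht (by rw [(hinv t ht).2]; exact hc.ne')
    rwa [(hinv t ht).2] at h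
  have hle : ∀ t, 0 ≤ t → v₁ t ≤ v₂ t := fun t ht =>
    abs_le_of_sq_le_sq' (by linarith [(hinv t ht).1]) (hv₂pos t ht).le |>.2
  have hcoef : 2 * um / σ 0 < 0 := div_neg_of_neg_of_pos (by linarith) hc
  have hanti : AntitoneOn W (Set.Ici 0) := by
    refine antitoneOn_of_hasDerivWithinAt_nonpos (convex_Ici 0)
      (fun t ht => (hWcont t ht).continuousWithinAt)
      (fun t ht => (hWd t (interior_subset ht)).hasDerivWithinAt) (fun t ht => ?_)
    exact mul_nonpos_of_nonpos_of_nonneg hcoef.le (sub_nonneg.2 (hle t (interior_subset ht)))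
  set M := W 0 + V ^ 2 + 1 with hM
  have hW0 : 0 ≤ W 0 := (hinv 0 le_rfl).1
  have hM1 : 1 ≤ M := by nlinarith
  have hv₂M : ∀ t, 0 ≤ t → v₂ t ≤ M := by
    intro t ht
    have h1 : v₂ t ^ 2 - v₁ t ^ 2 ≤ W 0 := hanti Set.self_mem_Ici ht ht
    have h2 := hv₁bnd t ht
    have h3 : v₁ t ^ 2 ≤ V ^ 2 := pow_le_pow_left₀ h2.1 h2.2 2
    nlinarith
  set k := -(2 * um / σ 0) / (V + M) with hk
  have hVM : 0 < V + M := by linarith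
  have hkpos : 0 < k := div_pos (by linarith) hVM
  have hexp : AntitoneOn (fun t => W t * Real.exp (k * t)) (Set.Ici 0) := by
    have hd : ∀ t, 0 ≤ t → HasDerivAt (fun t => W t * Real.exp (k * t))
        (2 * um / σ 0 * (v₂ t - v₁ t) * Real.exp (k * t) + W t * (Real.exp (k * t) * (k * 1))) t :=
      fun t ht => (hWd t ht).mul (((hasDerivAt_id t).const_mul k).exp)
    refine antitoneOn_of_hasDerivWithinAt_nonpos (convex_Ici 0)
      (fun t ht => (hd t ht).continuousAt.continuousWithinAt)
      (fun t ht => (hd t (interior_subset ht)).hasDerivWithinAt) (fun t ht => ?_)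
    have ht0 : 0 ≤ t := interior_subset ht
    have h1 : k * W t ≤ -(2 * um / σ 0) * (v₂ t - v₁ t) := by
      have h2 : W t ≤ (V + M) * (v₂ t - v₁ t) := by
        simp only [hWdef]
        nlinarith [hle t ht0, hv₂M t ht0, (hv₁bnd t ht0).2]
      calc k * W t ≤ k * ((V + M) * (v₂ t - v₁ t)) := by gcongr
        _ = _ := by rw [hk, ← mul_assoc, div_mul_cancel₀ _ hVM.ne']
    nlinarith [Real.exp_pos (k * t)]
  have hbound : ∀ t, 0 ≤ t → (v₂ t - v₁ t) ^ 2 ≤ W 0 * Real.exp (-(k * t)) := by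
    intro t ht
    have h1 := hexp Set.self_mem_Ici ht ht
    simp only [mul_zero, Real.exp_zero, mul_one] at h1
    rw [Real.exp_neg, ← div_eq_mul_inv]
    refine le_trans ?_ ((le_div_iff₀ (Real.exp_pos _)).2 h1)
    simp only [hWdef]
    nlinarith [hle t ht, (hv₁bnd t ht).1]
  have hlim : Filter.Tendsto (fun t => W 0 * Real.exp (-(k * t))) Filter.atTop (nhds 0) := by
    simpa using (Real.tendsto_exp_neg_atTop_nhds_zero.comp
      (Filter.tendsto_id.const_mul_atTop hkpos)).const_mul (W 0)
  have hsq : Filter.Tendsto (fun t => (v₂ t - v₁ t) ^ 2) Filter.atTop (nhds 0) :=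
    squeeze_zero' (Filter.Eventually.of_forall fun t => sq_nonneg _)
      (Filter.eventually_atTop.2 ⟨0, hbound⟩) hlim
  rw [tendsto_zero_iff_abs_tendsto_zero]
  simpa [Function.comp_def, Real.sqrt_sq_eq_abs] using hsq.sqrt
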